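/- arXiv:1404.3746 — 5 statements merged into one kernel-verified Lean document; each statement's English description precedes it below -/
import Mathlib

section
/- Strong TRO equivalence is transitive: Let H, K, L be complex Hilbert spaces, let A ⊆ B(H), B ⊆ B(K), C ⊆ B(L) be norm-closed subalgebras, and suppose there are TROs M ⊆ B(H,K) and N ⊆ B(K,L) such that A = [M*BM], B = [MAM*], B = [N*CN], and C = [NBN*]. Then there exists a TRO T ⊆ B(H,L) such that A = [T*CT] and C = [TAT*]. -/
noncomputable section

open ContinuousLinearMap

/-- The norm-closed linear span of a set of operators. -/
def clspan {V : Type*} [NormedAddCommGroup V] [NormedSpace ℂ V] (S : Set V) : Set V :=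
  closure (Submodule.span ℂ S : Set V)

/-- A set is a norm-closed linear subspace. -/
def IsClosedSubspace {V : Type*} [NormedAddCommGroup V] [NormedSpace ℂ V] (S : Set V) : Prop :=
  IsClosed S ∧ ∃ p : Submodule ℂ V, (p : Set V) = S

variable {H K L R : Type*}
  [NormedAddCommGroup H] [InnerProductSpace ℂ H] [CompleteSpace H]
  [NormedAddCommGroup K] [InnerProductSpace ℂ K] [CompleteSpace K]
  [NormedAddCommGroup L] [InnerProductSpace ℂ L] [CompleteSpace L]
  [NormedAddCommGroup R] [InnerProductSpace ℂ R] [CompleteSpace R]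

/-- A ternary ring of operators: a norm-closed subspace `M ⊆ B(H,K)` with `M M* M ⊆ M`. -/
def IsTRO (M : Set (H →L[ℂ] K)) : Prop :=
  IsClosedSubspace M ∧
    ∀ m₁ ∈ M, ∀ m₂ ∈ M, ∀ m₃ ∈ M, m₁ ∘L ((adjoint m₂) ∘L m₃) ∈ M

/-- A norm-closed subalgebra of `B(H)`. -/
def IsClosedSubalgebra (A : Set (H →L[ℂ] H)) : Prop :=
  IsClosedSubspace A ∧ ∀ a ∈ A, ∀ b ∈ A, a * b ∈ A

/-- `[M* B M]`, the norm-closed linear span of `{m₁* b m₂ : m₁, m₂ ∈ M, b ∈ B}`. -/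
def conjTRO (M : Set (H →L[ℂ] K)) (B : Set (K →L[ℂ] K)) : Set (H →L[ℂ] H) :=
  clspan {x | ∃ m₁ ∈ M, ∃ m₂ ∈ M, ∃ b ∈ B, x = (adjoint m₁) ∘L (b ∘L m₂)}

/-- `[M A M*]`, the norm-closed linear span of `{m₁ a m₂* : m₁, m₂ ∈ M, a ∈ A}`. -/
def conjTRO' (M : Set (H →L[ℂ] K)) (A : Set (H →L[ℂ] H)) : Set (K →L[ℂ] K) :=
  clspan {x | ∃ m₁ ∈ M, ∃ m₂ ∈ M, ∃ a ∈ A, x = m₁ ∘L (a ∘L (adjoint m₂))}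

/-- An algebra `A ⊆ B(H)` acts nondegenerately: the span of `A(H)` is dense in `H`. -/
def Nondegenerate (A : Set (H →L[ℂ] H)) : Prop :=
  Dense (Submodule.span ℂ {v : H | ∃ a ∈ A, ∃ h : H, v = a h} : Set H)

/-- A contractive approximate identity for `A`: a net `(e t)` in the unit ball of `A`
with `‖e t * a - a‖ → 0` and `‖a * e t - a‖ → 0` for every `a ∈ A`. -/
def HasCai (A : Set (H →L[ℂ] H)) : Prop :=
  ∃ (ι : Type) (_ : Preorder ι) (_ : IsDirected ι (· ≤ ·)) (_ : Nonempty ι)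
    (e : ι → (H →L[ℂ] H)),
    (∀ t, e t ∈ A) ∧ (∀ t, ‖e t‖ ≤ 1) ∧
    ∀ a ∈ A, Filter.Tendsto (fun t => ‖e t * a - a‖) Filter.atTop (nhds 0) ∧
      Filter.Tendsto (fun t => ‖a * e t - a‖) Filter.atTop (nhds 0)

/-- A countable approximate identity for `A`: a sequence `(e n)` in `A` with
`‖e n * a - a‖ → 0` and `‖a * e n - a‖ → 0` for every `a ∈ A`. -/
def HasCountableAI (A : Set (H →L[ℂ] H)) : Prop :=
  ∃ e : ℕ → (H →L[ℂ] H), (∀ n, e n ∈ A) ∧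
    ∀ a ∈ A, Filter.Tendsto (fun n => ‖e n * a - a‖) Filter.atTop (nhds 0) ∧
      Filter.Tendsto (fun n => ‖a * e n - a‖) Filter.atTop (nhds 0)

/-- The operator on the ℓ²-direct sum `R^n` associated to an `n × n` matrix of operators. -/
def matrixOp {n : ℕ} (x : Fin n → Fin n → (R →L[ℂ] R)) :
    (PiLp 2 fun _ : Fin n => R) →L[ℂ] (PiLp 2 fun _ : Fin n => R) :=
  ((PiLp.continuousLinearEquiv 2 ℂ (fun _ : Fin n => R)).symm.toContinuousLinearMap.comp
      (ContinuousLinearMap.pi fun i =>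
        ∑ j, (x i j).comp (ContinuousLinearMap.proj j))).comp
    (PiLp.continuousLinearEquiv 2 ℂ (fun _ : Fin n => R)).toContinuousLinearMap

/-- `φ` is completely isometric on a subspace `A ⊆ B(R)`: every matrix amplification of `φ`
preserves the operator matrix norms. -/
def CompletelyIsometricOn (A : Set (R →L[ℂ] R)) (φ : (R →L[ℂ] R) → (H →L[ℂ] H)) : Prop :=
  ∀ (n : ℕ) (x : Fin n → Fin n → (R →L[ℂ] R)), (∀ i j, x i j ∈ A) →
    ‖matrixOp (fun i j => φ (x i j))‖ = ‖matrixOp x‖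

/-- `α` is a completely isometric nondegenerate representation of the operator algebra
`A ⊆ B(R)` on the Hilbert space `H`: it is linear and multiplicative on `A`,
completely isometric on `A`, and the span of `α(A)H` is dense in `H`. -/
def IsCIRepOn (A : Set (R →L[ℂ] R)) (α : (R →L[ℂ] R) → (H →L[ℂ] H)) : Prop :=
  (∀ a ∈ A, ∀ b ∈ A, α (a + b) = α a + α b) ∧
  (∀ (c : ℂ), ∀ a ∈ A, α (c • a) = c • α a) ∧
  (∀ a ∈ A, ∀ b ∈ A, α (a * b) = α a * α b) ∧
  CompletelyIsometricOn A α ∧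
  Dense (Submodule.span ℂ {v : H | ∃ a ∈ A, ∃ h : H, v = α a h} : Set H)

/-- Two concretely represented operator algebras are strongly TRO equivalent. -/
def StronglyTROEquivalent (X : Set (H →L[ℂ] H)) (Y : Set (K →L[ℂ] K)) : Prop :=
  ∃ M : Set (H →L[ℂ] K), IsTRO M ∧ X = conjTRO M Y ∧ Y = conjTRO' M X

/-- Two operator algebras are strongly Δ-equivalent: they admit completely isometric
nondegenerate representations with strongly TRO equivalent ranges. -/
def StronglyDeltaEquivalent (A : Set (H →L[ℂ] H)) (B : Set (K →L[ℂ] K)) : Prop :=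
  ∃ (H' K' : Type) (_ : NormedAddCommGroup H') (_ : InnerProductSpace ℂ H')
    (_ : CompleteSpace H') (_ : NormedAddCommGroup K') (_ : InnerProductSpace ℂ K')
    (_ : CompleteSpace K')
    (α : (H →L[ℂ] H) → (H' →L[ℂ] H')) (β : (K →L[ℂ] K) → (K' →L[ℂ] K')),
    IsCIRepOn A α ∧ IsCIRepOn B β ∧ StronglyTROEquivalent (α '' A) (β '' B)

/-- The Hilbert space `ℓ²(H)` of square-summable sequences in `H`. -/
abbrev l2 (H : Type*) [NormedAddCommGroup H] [InnerProductSpace ℂ H] : Type _ :=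
  lp (fun _ : ℕ => H) 2

/-- The isometric embedding `S_i` of `H` onto the `i`-th coordinate of `ℓ²(H)`. -/
def lpSingle (i : ℕ) : H →L[ℂ] l2 H :=
  LinearMap.mkContinuous
    { toFun := fun a => lp.single 2 i a
      map_add' := fun a b => by
        apply lp.ext
        funext j
        by_cases h : j = i
        · subst h; simp [lp.single_apply_self]
        · simp [lp.single_apply_ne _ _ _ h, lp.coeFn_add]
      map_smul' := fun c a => by simp }
    1 (fun a => by
      simpa using (lp.norm_single (p := 2) (by norm_num) (fun _ : ℕ => a) i).le)

/-- The stabilization `K_∞(A) = [{S_i a S_j* : a ∈ A, i, j ∈ ℕ}] ⊆ B(ℓ²(H))`. -/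
def Kinf (A : Set (H →L[ℂ] H)) : Set (l2 H →L[ℂ] l2 H) :=
  clspan {x | ∃ a ∈ A, ∃ i j : ℕ, x = (lpSingle i) ∘L (a ∘L (adjoint (lpSingle j)))}



theorem clspan_sub {V : Type*} [NormedAddCommGroup V] [NormedSpace ℂ V] (S : Set V) :
    IsClosedSubspace (clspan S) :=
  ⟨isClosed_closure, (Submodule.span ℂ S).topologicalClosure, rfl⟩

theorem mem_clspan {V : Type*} [NormedAddCommGroup V] [NormedSpace ℂ V] {S : Set V} {x : V}
    (h : x ∈ S) : x ∈ clspan S :=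
  subset_closure (Submodule.subset_span h)

theorem clspan_map {V W : Type*} [NormedAddCommGroup V] [NormedSpace ℂ V]
    [NormedAddCommGroup W] [NormedSpace ℂ W] {S : Set V} {P : Set W} (hP : IsClosedSubspace P)
    (f : V → W) (hc : Continuous f) (hadd : ∀ x y, f (x + y) = f x + f y)
    (hsmul : ∀ (c : ℂ) x, ∃ c' : ℂ, f (c • x) = c' • f x)
    (hS : ∀ x ∈ S, f x ∈ P) : ∀ x ∈ clspan S, f x ∈ P := by
  obtain ⟨hcl, p, rfl⟩ := hP
  have h0 : f 0 = 0 := by simpa using hadd 0 0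
  have : clspan S ⊆ f ⁻¹' (p : Set W) := by
    refine closure_minimal ?_ (hcl.preimage hc)
    intro x hx
    induction hx using Submodule.span_induction with
    | mem x hx => exact hS x hx
    | zero => simp [h0]
    | add x y _ _ hx hy =>
      simp only [Set.mem_preimage, hadd] at *
      exact p.add_mem hx hy
    | smul c x _ hx =>
      obtain ⟨c', h⟩ := hsmul c x
      simp only [Set.mem_preimage, h] at *
      exact p.smul_mem _ hx
  exact this

theorem clspan_le {V : Type*} [NormedAddCommGroup V] [NormedSpace ℂ V]
    {S : Set V} {P : Set V} (hP : IsClosedSubspace P) (hS : ∀ x ∈ S, x ∈ P) : clspan S ⊆ P :=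
  clspan_map hP id continuous_id (fun _ _ => rfl) (fun c _ => ⟨c, rfl⟩) hS

theorem clspan_comp {E F G J : Type*}
    [NormedAddCommGroup E] [InnerProductSpace ℂ E]
    [NormedAddCommGroup F] [InnerProductSpace ℂ F]
    [NormedAddCommGroup G] [InnerProductSpace ℂ G]
    [NormedAddCommGroup J] [InnerProductSpace ℂ J]
    {S : Set (F →L[ℂ] G)} {P : Set (E →L[ℂ] J)} (hP : IsClosedSubspace P)
    (u : G →L[ℂ] J) (v : E →L[ℂ] F)
    (hS : ∀ x ∈ S, u ∘L (x ∘L v) ∈ P) : ∀ x ∈ clspan S, u ∘L (x ∘L v) ∈ P :=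
  clspan_map hP (fun x => u ∘L (x ∘L v)) (by fun_prop)
    (fun x y => by ext; simp) (fun c x => ⟨c, by ext; simp⟩) hS

theorem clspan_comp_adj {E F G J : Type*}
    [NormedAddCommGroup E] [InnerProductSpace ℂ E]
    [NormedAddCommGroup F] [InnerProductSpace ℂ F] [CompleteSpace F]
    [NormedAddCommGroup G] [InnerProductSpace ℂ G] [CompleteSpace G]
    [NormedAddCommGroup J] [InnerProductSpace ℂ J]
    {S : Set (G →L[ℂ] F)} {P : Set (E →L[ℂ] J)} (hP : IsClosedSubspace P)
    (u : G →L[ℂ] J) (v : E →L[ℂ] F)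
    (hS : ∀ x ∈ S, u ∘L ((adjoint x) ∘L v) ∈ P) :
    ∀ x ∈ clspan S, u ∘L ((adjoint x) ∘L v) ∈ P :=
  clspan_map hP (fun x => u ∘L ((adjoint x) ∘L v))
    (by
      have : Continuous (fun x : G →L[ℂ] F => adjoint x) := adjoint.continuous
      fun_prop)
    (fun x y => by ext; simp) (fun c x => ⟨star c, by
      have h : adjoint (c • x) = star c • adjoint x := adjoint.map_smulₛₗ c x
      ext; simp [h]⟩) hS

/-- `d` multiplies `B` into itself on both sides. -/
def MulP (B : Set (K →L[ℂ] K)) (d : K →L[ℂ] K) : Prop :=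
  ∀ b ∈ B, d ∘L b ∈ B ∧ b ∘L d ∈ B

/-- `d` and its adjoint multiply `B` into itself. -/
def MulD (B : Set (K →L[ℂ] K)) (d : K →L[ℂ] K) : Prop :=
  MulP B d ∧ MulP B (adjoint d)

theorem MulD.comp {B : Set (K →L[ℂ] K)} {d e : K →L[ℂ] K} (hd : MulD B d) (he : MulD B e) :
    MulD B (d ∘L e) := by
  refine ⟨fun b hb => ⟨?_, ?_⟩, fun b hb => ⟨?_, ?_⟩⟩
  · exact (hd.1 _ (he.1 b hb).1).1
  · exact (he.1 _ (hd.1 b hb).2).2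
  · rw [adjoint_comp]; exact (he.2 _ (hd.2 b hb).1).1
  · rw [adjoint_comp]; exact (hd.2 _ (he.2 b hb).2).2

theorem MulD.adj {B : Set (K →L[ℂ] K)} {d : K →L[ℂ] K} (hd : MulD B d) :
    MulD B (adjoint d) := ⟨hd.2, by rw [adjoint_adjoint]; exact hd.1⟩

theorem MulD.one {B : Set (K →L[ℂ] K)} : MulD B (ContinuousLinearMap.id ℂ K) := by
  have h : MulP B (ContinuousLinearMap.id ℂ K) := fun b hb => by simpa using hb
  refine ⟨h, ?_⟩
  rw [adjoint_id]; exact h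

theorem mulP_left {M : Set (H →L[ℂ] K)} (hM : IsTRO M) (A : Set (H →L[ℂ] H))
    {m₁ m₂ : H →L[ℂ] K} (h₁ : m₁ ∈ M) (h₂ : m₂ ∈ M) :
    MulP (conjTRO' M A) (m₁ ∘L adjoint m₂) := by
  intro b hb
  constructor
  · refine clspan_comp (clspan_sub _) (m₁ ∘L adjoint m₂) (ContinuousLinearMap.id ℂ K) ?_ b hb
    rintro _ ⟨p, hp, q, hq, a, ha, rfl⟩
    exact mem_clspan ⟨_, hM.2 _ h₁ _ h₂ _ hp, q, hq, a, ha, rfl⟩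
  · refine clspan_comp (clspan_sub _) (ContinuousLinearMap.id ℂ K) (m₁ ∘L adjoint m₂) ?_ b hb
    rintro _ ⟨p, hp, q, hq, a, ha, rfl⟩
    refine mem_clspan ⟨p, hp, _, hM.2 _ h₂ _ h₁ _ hq, a, ha, ?_⟩
    simp only [adjoint_comp, adjoint_adjoint]; rfl

theorem mulP_right {N : Set (K →L[ℂ] L)} (hN : IsTRO N) (C : Set (L →L[ℂ] L))
    {n₁ n₂ : K →L[ℂ] L} (h₁ : n₁ ∈ N) (h₂ : n₂ ∈ N) :
    MulP (conjTRO N C) (adjoint n₁ ∘L n₂) := by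
  intro b hb
  constructor
  · refine clspan_comp (clspan_sub _) (adjoint n₁ ∘L n₂) (ContinuousLinearMap.id ℂ K) ?_ b hb
    rintro _ ⟨p, hp, q, hq, a, ha, rfl⟩
    refine mem_clspan ⟨_, hN.2 _ hp _ h₂ _ h₁, q, hq, a, ha, ?_⟩
    simp only [adjoint_comp, adjoint_adjoint]; rfl
  · refine clspan_comp (clspan_sub _) (ContinuousLinearMap.id ℂ K) (adjoint n₁ ∘L n₂) ?_ b hb
    rintro _ ⟨p, hp, q, hq, a, ha, rfl⟩
    exact mem_clspan ⟨p, hp, _, hN.2 _ hq _ h₁ _ h₂, a, ha, rfl⟩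

/-- Strong TRO equivalence is transitive. -/
theorem strongTROEquivalence_trans
    (A : Set (H →L[ℂ] H)) (B : Set (K →L[ℂ] K)) (C : Set (L →L[ℂ] L))
    (hA : IsClosedSubalgebra A) (hB : IsClosedSubalgebra B) (hC : IsClosedSubalgebra C)
    (M : Set (H →L[ℂ] K)) (N : Set (K →L[ℂ] L)) (hM : IsTRO M) (hN : IsTRO N)
    (hAB : A = conjTRO M B) (hBA : B = conjTRO' M A)
    (hBC : B = conjTRO N C) (hCB : C = conjTRO' N B) :
    ∃ T : Set (H →L[ℂ] L), IsTRO T ∧ A = conjTRO T C ∧ C = conjTRO' T A := by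
  have hD1 : ∀ m₁ ∈ M, ∀ m₂ ∈ M, MulD B (m₁ ∘L adjoint m₂) := by
    intro m₁ h₁ m₂ h₂
    rw [hBA]
    refine ⟨mulP_left hM A h₁ h₂, ?_⟩
    rw [adjoint_comp, adjoint_adjoint]
    exact mulP_left hM A h₂ h₁
  have hD2 : ∀ n₁ ∈ N, ∀ n₂ ∈ N, MulD B (adjoint n₁ ∘L n₂) := by
    intro m₁ h₁ m₂ h₂
    rw [hBC]
    refine ⟨mulP_right hN C h₁ h₂, ?_⟩
    rw [adjoint_comp, adjoint_adjoint]
    exact mulP_right hN C h₂ h₁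
  have hAs := hA.1
  have hCs := hC.1
  let G : Set (H →L[ℂ] L) := {x | ∃ n ∈ N, ∃ d, MulD B d ∧ ∃ m ∈ M, x = n ∘L (d ∘L m)}
  have hG : ∀ n ∈ N, ∀ m ∈ M, n ∘L m ∈ clspan G := fun n hn m hm =>
    mem_clspan ⟨n, hn, _, MulD.one, m, hm, rfl⟩
  refine ⟨clspan G, ⟨clspan_sub _, ?_⟩, ?_, ?_⟩
  · intro t₁ h₁ t₂ h₂ t₃ h₃
    refine clspan_comp (clspan_sub G) (ContinuousLinearMap.id ℂ L) (adjoint t₂ ∘L t₃) ?_ t₁ h₁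
    rintro _ ⟨n₁, hn₁, d₁, hd₁, m₁, hm₁, rfl⟩
    refine clspan_comp_adj (clspan_sub G) (n₁ ∘L (d₁ ∘L m₁)) t₃ ?_ t₂ h₂
    rintro _ ⟨n₂, hn₂, d₂, hd₂, m₂, hm₂, rfl⟩
    refine clspan_comp (clspan_sub G) ((n₁ ∘L (d₁ ∘L m₁)) ∘L adjoint (n₂ ∘L (d₂ ∘L m₂)))
      (ContinuousLinearMap.id ℂ H) ?_ t₃ h₃
    rintro _ ⟨n₃, hn₃, d₃, hd₃, m₃, hm₃, rfl⟩
    refine mem_clspan ⟨n₁, hn₁, _, hd₁.comp ((hD1 m₁ hm₁ m₂ hm₂).comp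
      (hd₂.adj.comp ((hD2 n₂ hn₂ n₃ hn₃).comp hd₃))), m₃, hm₃, ?_⟩
    simp only [adjoint_comp]; rfl
  · apply Set.Subset.antisymm
    · rw [hAB]
      refine clspan_le (clspan_sub _) ?_
      rintro _ ⟨m₁, hm₁, m₂, hm₂, b, hb, rfl⟩
      rw [hBC] at hb
      refine clspan_comp (clspan_sub _) (adjoint m₁) m₂ ?_ b hb
      rintro _ ⟨n₁, hn₁, n₂, hn₂, c, hc, rfl⟩
      refine mem_clspan ⟨_, hG n₁ hn₁ m₁ hm₁, _, hG n₂ hn₂ m₂ hm₂, c, hc, ?_⟩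
      simp only [adjoint_comp]; rfl
    · refine clspan_le hAs ?_
      rintro _ ⟨t₁, ht₁, t₂, ht₂, c, hc, rfl⟩
      refine clspan_comp_adj hAs (ContinuousLinearMap.id ℂ H) (c ∘L t₂) ?_ t₁ ht₁
      rintro _ ⟨n₁, hn₁, d₁, hd₁, m₁, hm₁, rfl⟩
      refine clspan_comp hAs (adjoint (n₁ ∘L (d₁ ∘L m₁)) ∘L c)
        (ContinuousLinearMap.id ℂ H) ?_ t₂ ht₂
      rintro _ ⟨n₂, hn₂, d₂, hd₂, m₂, hm₂, rfl⟩
      have hb : adjoint n₁ ∘L (c ∘L n₂) ∈ B := by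
        rw [hBC]; exact mem_clspan ⟨n₁, hn₁, n₂, hn₂, c, hc, rfl⟩
      rw [hAB]
      refine mem_clspan ⟨m₁, hm₁, m₂, hm₂, _, (hd₁.2 _ (hd₂.1 _ hb).2).1, ?_⟩
      simp only [adjoint_comp]; rfl
  · apply Set.Subset.antisymm
    · rw [hCB]
      refine clspan_le (clspan_sub _) ?_
      rintro _ ⟨n₁, hn₁, n₂, hn₂, b, hb, rfl⟩
      rw [hBA] at hb
      refine clspan_comp (clspan_sub _) n₁ (adjoint n₂) ?_ b hb
      rintro _ ⟨m₁, hm₁, m₂, hm₂, a, ha, rfl⟩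
      refine mem_clspan ⟨_, hG n₁ hn₁ m₁ hm₁, _, hG n₂ hn₂ m₂ hm₂, a, ha, ?_⟩
      simp only [adjoint_comp]; rfl
    · refine clspan_le hCs ?_
      rintro _ ⟨t₁, ht₁, t₂, ht₂, a, ha, rfl⟩
      refine clspan_comp hCs (ContinuousLinearMap.id ℂ L) (a ∘L adjoint t₂) ?_ t₁ ht₁
      rintro _ ⟨n₁, hn₁, d₁, hd₁, m₁, hm₁, rfl⟩
      refine clspan_comp_adj hCs ((n₁ ∘L (d₁ ∘L m₁)) ∘L a)
        (ContinuousLinearMap.id ℂ L) ?_ t₂ ht₂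
      rintro _ ⟨n₂, hn₂, d₂, hd₂, m₂, hm₂, rfl⟩
      have hb : m₁ ∘L (a ∘L adjoint m₂) ∈ B := by
        rw [hBA]; exact mem_clspan ⟨m₁, hm₁, m₂, hm₂, a, ha, rfl⟩
      rw [hCB]
      refine mem_clspan ⟨n₁, hn₁, n₂, hn₂, _, (hd₁.1 _ (hd₂.2 _ hb).2).1, ?_⟩
      simp only [adjoint_comp]; rfl
end
end

section
/- Approximate identities of special form for a TRO: Let H, K be complex Hilbert spaces and let M ⊆ B(H,K) be a TRO. Then for every finite subset {x₁, …, x_p} of M and every ε > 0: (i) there exist finitely many m₁, …, m_l ∈ M such that ‖Σ_{i=1}^{l} m_i* m_i‖ ≤ 1 and ‖x_j (Σ_{i=1}^{l} m_i* m_i) − x_j‖ < ε for all j = 1, …, p; and (ii) there exist finitely many n₁, …, n_k ∈ M such that ‖Σ_{i=1}^{k} n_i n_i*‖ ≤ 1 and ‖(Σ_{i=1}^{k} n_i n_i*) x_j − x_j‖ < ε for all j = 1, …, p. -/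
noncomputable section

open ContinuousLinearMap

variable {H K L R : Type*}
  [NormedAddCommGroup H] [InnerProductSpace ℂ H] [CompleteSpace H]
  [NormedAddCommGroup K] [InnerProductSpace ℂ K] [CompleteSpace K]
  [NormedAddCommGroup L] [InnerProductSpace ℂ L] [CompleteSpace L]
  [NormedAddCommGroup R] [InnerProductSpace ℂ R] [CompleteSpace R]

def troMult (M : Submodule ℂ (H →L[ℂ] K)) : StarSubalgebra ℝ (H →L[ℂ] H) where
  carrier := {b | ∀ y ∈ M, y ∘L b ∈ M ∧ y ∘L (star b) ∈ M}
  mul_mem' := by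
    intro a b ha hb y hy
    refine ⟨(hb _ (ha y hy).1).1, ?_⟩
    rw [star_mul]
    exact (ha _ (hb y hy).2).2
  add_mem' := by
    intro a b ha hb y hy
    rw [star_add, comp_add, comp_add]
    exact ⟨M.add_mem (ha y hy).1 (hb y hy).1, M.add_mem (ha y hy).2 (hb y hy).2⟩
  algebraMap_mem' := by
    intro r y hy
    have h1 : y ∘L (algebraMap ℝ (H →L[ℂ] H) r) = (r : ℂ) • y := by
      ext v
      simp [Algebra.algebraMap_eq_smul_one]
    have h2 : star (algebraMap ℝ (H →L[ℂ] H) r) = algebraMap ℝ (H →L[ℂ] H) r := by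
      rw [← algebraMap_star_comm]; simp
    rw [h2, h1]
    exact ⟨M.smul_mem _ hy, M.smul_mem _ hy⟩
  star_mem' := by
    intro a ha y hy
    rw [star_star]
    exact (ha y hy).symm

theorem troMult_closed (M : Submodule ℂ (H →L[ℂ] K)) (hM : IsClosed (M : Set (H →L[ℂ] K))) :
    IsClosed (troMult M : Set (H →L[ℂ] H)) := by
  have : (troMult M : Set (H →L[ℂ] H)) =
      ⋂ y ∈ M, ((fun b => y ∘L b) ⁻¹' (M : Set (H →L[ℂ] K)) ∩
        (fun b => y ∘L (star b)) ⁻¹' (M : Set (H →L[ℂ] K))) := by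
    ext b
    simp [troMult]
  rw [this]
  refine isClosed_biInter fun y _ => (hM.preimage ?_).inter (hM.preimage ?_)
  · exact continuous_const.clm_comp continuous_id
  · exact continuous_const.clm_comp continuous_star

set_option maxHeartbeats 1000000 in
theorem tro_half (M : Set (H →L[ℂ] K)) (hM : IsTRO M)
    (p : ℕ) (x : Fin p → (H →L[ℂ] K)) (hx : ∀ j, x j ∈ M) (ε : ℝ) (hε : 0 < ε) :
    ∃ (l : ℕ) (m : Fin l → (H →L[ℂ] K)), (∀ i, m i ∈ M) ∧
      ‖∑ i, (adjoint (m i)) ∘L (m i)‖ ≤ 1 ∧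
      ∀ j, ‖(x j) ∘L (∑ i, (adjoint (m i)) ∘L (m i)) - x j‖ < ε := by
  obtain ⟨⟨hc, M, rfl⟩, htro⟩ := hM
  simp only [SetLike.mem_coe] at *
  set a : H →L[ℂ] H := ∑ i, (adjoint (x i)) ∘L (x i) with ha
  have ha0 : 0 ≤ a := by
    rw [nonneg_iff_isPositive]
    exact isPositive_sum _ fun i _ => isPositive_adjoint_comp_self _
  have hsa : IsSelfAdjoint a := ha0.isSelfAdjoint
  have hspec : ∀ t ∈ spectrum ℝ a, 0 ≤ t := fun t ht => spectrum_nonneg_of_nonneg ha0 ht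
  have haS : a ∈ troMult M := by
    have : ∀ y ∈ M, y ∘L a ∈ M := by
      intro y hy
      rw [ha, comp_finsetSum]
      exact M.sum_mem fun i _ => htro y hy _ (hx i) _ (hx i)
    intro y hy
    rw [hsa.star_eq]
    exact ⟨this y hy, this y hy⟩
  obtain ⟨δ, hδ, hδε⟩ : ∃ δ : ℝ, 0 < δ ∧ δ = (ε / 2) ^ 2 := ⟨_, by positivity, rfl⟩
  obtain ⟨f, hf, hff⟩ : ∃ f : ℝ → ℝ, Continuous f ∧ ∀ t, f t * f t = (max t 0 + δ)⁻¹ := by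
    have hpos : ∀ t : ℝ, 0 < max t 0 + δ := fun t => by positivity
    refine ⟨fun t => (Real.sqrt (max t 0 + δ))⁻¹, ?_, fun t => ?_⟩
    · refine Continuous.inv₀ (by fun_prop) fun t => ?_
      exact (Real.sqrt_pos.2 (hpos t)).ne'
    · rw [← mul_inv, Real.mul_self_sqrt (hpos t).le]
  have c0 : Continuous fun t : ℝ => t := continuous_id
  have c1 : Continuous fun t => f t * t := hf.mul c0
  have c2 : Continuous fun t => f t * t * f t := c1.mul hf
  have c3 : Continuous fun t => f t * t * f t - 1 := c2.sub continuous_const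
  have c4 : Continuous fun t => (f t * t * f t - 1) * t := c3.mul c0
  set g : H →L[ℂ] H := cfc f a with hg
  have hgS : g ∈ troMult M :=
    StarAlgebra.elemental.le_of_mem (troMult_closed M hc) haS (cfc_mem_elemental f a)
  have hgsa : adjoint g = g := (cfc_predicate f a : IsSelfAdjoint g)
  have hsum : ∑ i, (adjoint (x i ∘L g)) ∘L (x i ∘L g) = g * a * g := by
    simp only [adjoint_comp, hgsa, ha, Finset.mul_sum, Finset.sum_mul]
    rfl
  have hgag : g * a * g = cfc (fun t => f t * t * f t) a := by
    rw [cfc_mul (fun t => f t * t) f a c1.continuousOn hf.continuousOn,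
      cfc_mul f (fun t => t) a hf.continuousOn c0.continuousOn, cfc_id' ℝ a]
  have hr : g * a * g - 1 = cfc (fun t => f t * t * f t - 1) a := by
    rw [cfc_sub (fun t => f t * t * f t) (fun _ => 1) a c2.continuousOn continuousOn_const, hgag, cfc_const_one ℝ a]
  set r := g * a * g - 1 with hrdef
  have hrsa : adjoint r = r := by
    rw [hr]
    exact (cfc_predicate _ a : IsSelfAdjoint (cfc (fun t => f t * t * f t - 1) a))
  have hrar : r * a * r = cfc (fun t => (f t * t * f t - 1) * t * (f t * t * f t - 1)) a := by
    rw [cfc_mul (fun t => (f t * t * f t - 1) * t) (fun t => f t * t * f t - 1) a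
      c4.continuousOn c3.continuousOn,
      cfc_mul (fun t => f t * t * f t - 1) (fun t => t) a c3.continuousOn c0.continuousOn, cfc_id' ℝ a, ← hr]
  have hkey : ∀ t, 0 ≤ t → f t * t * f t = t / (t + δ) := fun t ht => by
    rw [mul_right_comm, hff, max_eq_left ht]; field_simp
  have hn : ‖r * a * r‖ ≤ δ := by
    rw [hrar]
    refine norm_cfc_le hδ.le fun t ht => ?_
    have ht := hspec t ht
    have : (f t * t * f t - 1) * t * (f t * t * f t - 1) = δ * (δ * t / (t + δ)^2) := by
      rw [hkey t ht]; field_simp; ring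
    rw [this, Real.norm_of_nonneg (by positivity)]
    refine mul_le_of_le_one_right hδ.le ?_
    rw [div_le_one (by positivity)]
    nlinarith [mul_nonneg hδ.le ht]
  refine ⟨p, fun i => x i ∘L g, fun i => (hgS _ (hx i)).1, ?_, fun j => ?_⟩
  · rw [hsum, hgag]
    refine norm_cfc_le zero_le_one fun t ht => ?_
    have ht := hspec t ht
    rw [hkey t ht, Real.norm_of_nonneg (by positivity), div_le_one (by positivity)]
    linarith
  · rw [hsum]
    have h1 : x j ∘L (g * a * g) - x j = x j ∘L r := by
      rw [hrdef, comp_sub]; rfl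
    rw [h1]
    refine lt_of_le_of_lt (opNorm_le_bound _ (M := ε / 2) (by positivity) fun v => ?_)
      (half_lt_self hε)
    refine le_of_sq_le_sq ?_ (by positivity)
    calc ‖(x j ∘L r) v‖ ^ 2 ≤ ∑ i, ‖x i (r v)‖ ^ 2 :=
          Finset.single_le_sum (f := fun i => ‖x i (r v)‖ ^ 2) (fun i _ => by positivity)
            (Finset.mem_univ j)
      _ = RCLike.re (inner ℂ ((r * a * r) v) v) := by
          have : (r * a * r) v = (adjoint r) (a (r v)) := by rw [hrsa]; rfl
          rw [this, adjoint_inner_left, ha, sum_apply, sum_inner, map_sum]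
          refine Finset.sum_congr rfl fun i _ => ?_
          rw [comp_apply, adjoint_inner_left, inner_self_eq_norm_sq]
      _ ≤ ‖(r * a * r) v‖ * ‖v‖ := re_inner_le_norm _ _
      _ ≤ (δ * ‖v‖) * ‖v‖ := by
          gcongr
          exact le_of_opNorm_le _ hn v
      _ = (ε / 2 * ‖v‖) ^ 2 := by rw [hδε]; ring

theorem tro_adjoint (M : Set (H →L[ℂ] K)) (hM : IsTRO M) :
    IsTRO {y : K →L[ℂ] H | adjoint y ∈ M} := by
  obtain ⟨⟨hc, M, rfl⟩, htro⟩ := hM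
  refine ⟨⟨hc.preimage (adjoint : (K →L[ℂ] H) ≃ₗᵢ⋆[ℂ] (H →L[ℂ] K)).continuous,
    { carrier := {y | adjoint y ∈ M}, add_mem' := ?_, zero_mem' := ?_, smul_mem' := ?_ }, rfl⟩, ?_⟩
  · intro a b ha hb
    simp only [Set.mem_setOf_eq, map_add] at *
    exact M.add_mem ha hb
  · simp
  · intro c a ha
    simp only [Set.mem_setOf_eq, map_smulₛₗ] at *
    exact M.smul_mem _ ha
  · intro a ha b hb c hc
    simp only [Set.mem_setOf_eq, adjoint_comp] at *
    exact htro _ hc _ hb _ ha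

/-- Approximate identities of special form for a TRO: for any finitely many
elements of `M` and `ε > 0` there are finite sums `Σ mᵢ* mᵢ` (resp. `Σ nᵢ nᵢ*`) of norm at
most `1` which approximately act as the identity on the right (resp. left). -/
theorem TRO_approximate_identities
    (M : Set (H →L[ℂ] K)) (hM : IsTRO M)
    (p : ℕ) (x : Fin p → (H →L[ℂ] K)) (hx : ∀ j, x j ∈ M) (ε : ℝ) (hε : 0 < ε) :
    (∃ (l : ℕ) (m : Fin l → (H →L[ℂ] K)), (∀ i, m i ∈ M) ∧
      ‖∑ i, (adjoint (m i)) ∘L (m i)‖ ≤ 1 ∧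
      ∀ j, ‖(x j) ∘L (∑ i, (adjoint (m i)) ∘L (m i)) - x j‖ < ε) ∧
    (∃ (k : ℕ) (n : Fin k → (H →L[ℂ] K)), (∀ i, n i ∈ M) ∧
      ‖∑ i, (n i) ∘L (adjoint (n i))‖ ≤ 1 ∧
      ∀ j, ‖(∑ i, (n i) ∘L (adjoint (n i))) ∘L (x j) - x j‖ < ε) := by
  refine ⟨tro_half M hM p x hx ε hε, ?_⟩
  obtain ⟨k, n, hn, h1, h2⟩ := tro_half _ (tro_adjoint M hM) p (fun j => adjoint (x j))
    (fun j => by simpa using hx j) ε hε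
  refine ⟨k, fun i => adjoint (n i), hn, by simpa using h1, fun j => ?_⟩
  have h := h2 j
  rw [← LinearIsometryEquiv.norm_map (adjoint : (K →L[ℂ] H) ≃ₗᵢ⋆[ℂ] (H →L[ℂ] K))] at h
  simpa [adjoint_comp] using h
end
end

section
/- Strong TRO equivalence passes to diagonals: Let H, K be complex Hilbert spaces, let A ⊆ B(H) and B ⊆ B(K) be norm-closed subalgebras, and let M ⊆ B(H,K) be a TRO with A = [M*BM] and B = [MAM*]. Let Δ(A) = A ∩ A* and Δ(B) = B ∩ B*, where A* = {a* : a ∈ A} and B* = {b* : b ∈ B}. Then Δ(A) = [M* Δ(B) M] and Δ(B) = [M Δ(A) M*], i.e. the diagonals Δ(A) and Δ(B) are strongly TRO equivalent via the same TRO M. -/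
noncomputable section

open ContinuousLinearMap

variable {H K L R : Type*}
  [NormedAddCommGroup H] [InnerProductSpace ℂ H] [CompleteSpace H]
  [NormedAddCommGroup K] [InnerProductSpace ℂ K] [CompleteSpace K]
  [NormedAddCommGroup L] [InnerProductSpace ℂ L] [CompleteSpace L]
  [NormedAddCommGroup R] [InnerProductSpace ℂ R] [CompleteSpace R]

open Filter Topology in
lemma exists_approx_filter {E : Type*} [NonUnitalCStarAlgebra E]
    (S : NonUnitalStarSubalgebra ℂ E) (hS : IsClosed (S : Set E)) :
    ∃ l : Filter E, l.NeBot ∧ (∀ᶠ e in l, e ∈ S ∧ ‖e‖ ≤ 1) ∧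
      ∀ d ∈ S, Tendsto (fun e => e * d) l (𝓝 d) := by
  have := hS
  let _ := CStarAlgebra.spectralOrder S
  let _ := CStarAlgebra.spectralOrderedRing S
  have hu := CStarAlgebra.increasingApproximateUnit S
  have := hu.neBot
  refine ⟨(CStarAlgebra.approximateUnit S).map (Subtype.val), inferInstance, ?_, ?_⟩
  · rw [eventually_map]
    filter_upwards [hu.eventually_norm] with e he
    exact ⟨e.2, he⟩
  · intro d hd
    rw [tendsto_map'_iff]
    exact (continuous_subtype_val.tendsto _).comp (hu.tendsto_mul_right ⟨d, hd⟩)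

lemma clspan_induct {V : Type*} [NormedAddCommGroup V] [NormedSpace ℂ V] {S : Set V}
    (W : Submodule ℂ V) (hW : IsClosed (W : Set V)) (h : S ⊆ W) : clspan S ⊆ W :=
  closure_minimal (Submodule.span_le.2 h) hW

/-- The closed span as a submodule. -/
def clsp {V : Type*} [NormedAddCommGroup V] [NormedSpace ℂ V] (S : Set V) : Submodule ℂ V :=
  (Submodule.span ℂ S).topologicalClosure

lemma coe_clsp {V : Type*} [NormedAddCommGroup V] [NormedSpace ℂ V] (S : Set V) :
    (clsp S : Set V) = clspan S := Submodule.topologicalClosure_coe _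

lemma mem_clsp {V : Type*} [NormedAddCommGroup V] [NormedSpace ℂ V] (S : Set V) (x : V) :
    x ∈ clsp S ↔ x ∈ clspan S := by rw [← coe_clsp]; rfl

lemma isClosed_clsp {V : Type*} [NormedAddCommGroup V] [NormedSpace ℂ V] (S : Set V) :
    IsClosed (clsp S : Set V) := Submodule.isClosed_topologicalClosure _

lemma subset_clsp {V : Type*} [NormedAddCommGroup V] [NormedSpace ℂ V] (S : Set V) {x : V}
    (hx : x ∈ S) : x ∈ clsp S :=
  Submodule.le_topologicalClosure _ (Submodule.subset_span hx)

lemma clsp_map {V W : Type*} [NormedAddCommGroup V] [NormedSpace ℂ V]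
    [NormedAddCommGroup W] [NormedSpace ℂ W] {S : Set V} {T : Submodule ℂ W}
    (hT : IsClosed (T : Set W)) (f : V →L[ℂ] W) (h : ∀ x ∈ S, f x ∈ T) :
    ∀ x ∈ clsp S, f x ∈ T := by
  intro x hx
  rw [mem_clsp] at hx
  exact clspan_induct (T.comap f.toLinearMap) (hT.preimage f.continuous) h hx

lemma clsp_star {E : Type*} [NormedAddCommGroup E] [NormedSpace ℂ E] [StarAddMonoid E]
    [StarModule ℂ E] [ContinuousStar E] {S : Set E} {T : Submodule ℂ E}
    (hT : IsClosed (T : Set E)) (h : ∀ x ∈ S, star x ∈ T) :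
    ∀ x ∈ clsp S, star x ∈ T := by
  intro x hx
  rw [mem_clsp] at hx
  refine clspan_induct (W := { carrier := {x | star x ∈ T}, add_mem' := ?_, zero_mem' := ?_, smul_mem' := ?_ })
    (hT.preimage continuous_star) h hx
  · intro a b ha hb; simpa using T.add_mem ha hb
  · simp
  · intro c a ha; simpa using T.smul_mem _ ha

/-- `[M* M]`. -/
def troSet (M : Set (H →L[ℂ] K)) : Set (H →L[ℂ] H) :=
  {x | ∃ m ∈ M, ∃ n ∈ M, x = (adjoint m) ∘L n}

/-- `[M* M]` as a star subalgebra. -/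
def troAlg (M : Set (H →L[ℂ] K))
    (hT : ∀ m₁ ∈ M, ∀ m₂ ∈ M, ∀ m₃ ∈ M, m₁ ∘L ((adjoint m₂) ∘L m₃) ∈ M) :
    NonUnitalStarSubalgebra ℂ (H →L[ℂ] H) :=
  { clsp (troSet M) with
    mul_mem' := by
      intro a b ha hb
      refine clsp_map (isClosed_clsp _) ((ContinuousLinearMap.mul ℂ (H →L[ℂ] H)).flip b)
        (fun x hx => ?_) a ha
      refine clsp_map (isClosed_clsp _) ((ContinuousLinearMap.mul ℂ (H →L[ℂ] H)) x)
        (fun y hy => ?_) b hb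
      obtain ⟨m, hm, n, hn, rfl⟩ := hx
      obtain ⟨p, hp, q, hq, rfl⟩ := hy
      exact subset_clsp _ ⟨m, hm, _, hT n hn p hp q hq, rfl⟩
    star_mem' := by
      intro a ha
      refine clsp_star (isClosed_clsp _) (fun x hx => ?_) a ha
      obtain ⟨m, hm, n, hn, rfl⟩ := hx
      refine subset_clsp _ ⟨n, hn, m, hm, ?_⟩
      rw [star_eq_adjoint, adjoint_comp, adjoint_adjoint] }

open Filter Topology in
lemma approx_A (M : Set (H →L[ℂ] K)) (B : Set (K →L[ℂ] K))
    (l : Filter (H →L[ℂ] H)) (h1 : ∀ᶠ e in l, ‖e‖ ≤ 1)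
    (h2 : ∀ d ∈ troSet M, Tendsto (fun e => e * d) l (𝓝 d)) :
    ∀ a ∈ conjTRO M B, Tendsto (fun e => e * a) l (𝓝 a) := by
  intro a ha
  have key : ∀ m ∈ M, Tendsto (fun e : H →L[ℂ] H => e ∘L adjoint m - adjoint m) l (𝓝 0) := by
    intro m hm
    have h3 := h2 _ ⟨m, hm, m, hm, rfl⟩
    rw [tendsto_iff_norm_sub_tendsto_zero] at h3
    rw [tendsto_zero_iff_norm_tendsto_zero]
    have h4 : Tendsto (fun e : H →L[ℂ] H => ‖e ∘L adjoint m - adjoint m‖ ^ 2) l (𝓝 0) := by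
      refine squeeze_zero' (Eventually.of_forall fun _ => by positivity) ?_
        (by simpa using h3.mul_const 2)
      filter_upwards [h1] with e he
      have h5 : ‖e ∘L adjoint m - adjoint m‖ ^ 2
          = ‖(e * (adjoint m ∘L m) - adjoint m ∘L m) ∘L (adjoint e - 1)‖ := by
        have h6 := norm_adjoint_comp_self (adjoint (e ∘L adjoint m - adjoint m))
        rw [adjoint_adjoint, LinearIsometryEquiv.norm_map] at h6
        rw [sq, ← h6]
        congr 1
        simp only [map_sub, adjoint_comp, adjoint_adjoint]
        ext x
        simp
      rw [h5]
      refine (opNorm_comp_le _ _).trans ?_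
      gcongr
      refine (norm_sub_le _ _).trans ?_
      have h7 : ‖(1 : H →L[ℂ] H)‖ ≤ 1 := norm_id_le
      rw [LinearIsometryEquiv.norm_map]
      linarith
    have h8 := h4.sqrt
    simpa using h8
  refine clspan_induct (W := { carrier := {a | Tendsto (fun e => e * a) l (𝓝 a)}, add_mem' := ?_, zero_mem' := ?_, smul_mem' := ?_ }) ?_ ?_ ha
  · intro a b ha hb
    simpa [mul_add] using Tendsto.add ha hb
  · simpa using tendsto_const_nhds
  · intro c a ha
    simpa using Tendsto.const_smul ha c
  · refine isClosed_of_closure_subset fun a ha => ?_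
    rw [Metric.mem_closure_iff] at ha
    change Tendsto _ _ _
    rw [Metric.tendsto_nhds]
    intro ε hε
    obtain ⟨b, hb, hab⟩ := ha (ε / 3) (by positivity)
    change Tendsto _ _ _ at hb
    filter_upwards [h1, Metric.tendsto_nhds.1 hb (ε / 3) (by positivity)] with e he hbe
    rw [dist_eq_norm] at *
    have h9 : e * a - a = e * (a - b) + (e * b - b) - (a - b) := by
      rw [mul_sub]; abel
    have h10 : ‖e * (a - b)‖ ≤ ‖a - b‖ :=
      (norm_mul_le _ _).trans (mul_le_of_le_one_left (norm_nonneg _) he)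
    rw [h9]
    have := norm_sub_le (e * (a - b) + (e * b - b)) (a - b)
    have := norm_add_le (e * (a - b)) (e * b - b)
    linarith
  · rintro x ⟨m, hm, n, hn, b, hb, rfl⟩
    change Tendsto _ _ _
    rw [tendsto_iff_norm_sub_tendsto_zero]
    have h3 := (key m hm).norm.mul_const ‖b ∘L n‖
    rw [norm_zero, zero_mul] at h3
    refine squeeze_zero (fun _ => norm_nonneg _) (fun e => ?_) h3
    refine le_trans (le_of_eq ?_) (opNorm_comp_le _ _)
    congr 1

open Filter Topology in
lemma diag_core (A : Set (H →L[ℂ] H)) (B : Set (K →L[ℂ] K)) (M : Set (H →L[ℂ] K))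
    (hT : ∀ m₁ ∈ M, ∀ m₂ ∈ M, ∀ m₃ ∈ M, m₁ ∘L ((adjoint m₂) ∘L m₃) ∈ M)
    (hAB : A = conjTRO M B)
    (hBA : ∀ m ∈ M, ∀ n ∈ M, ∀ a ∈ A, m ∘L (a ∘L adjoint n) ∈ B) :
    A ∩ {x | ∃ a ∈ A, x = star a} = conjTRO M (B ∩ {y | ∃ b ∈ B, y = star b}) := by
  have hgen : ∀ m ∈ M, ∀ n ∈ M, ∀ b ∈ B, (adjoint m) ∘L (b ∘L n) ∈ A := by
    intro m hm n hn b hb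
    rw [hAB]
    exact (mem_clsp _ _).1 (subset_clsp _ ⟨m, hm, n, hn, b, hb, rfl⟩)
  apply Set.Subset.antisymm
  · rintro a ⟨haA, a', ha', haa⟩
    obtain ⟨l, hl, hl1, hl2⟩ := exists_approx_filter (troAlg M hT) (isClosed_clsp _)
    have hap := approx_A M B l (hl1.mono fun _ h => h.2)
      (fun d hd => hl2 d (subset_clsp _ hd))
    rw [← hAB] at hap
    have t1 := hap a haA
    have t2 : Tendsto (fun e => a * star e) l (𝓝 a) := by
      have := (hap a' ha').star
      simpa [← haa] using this
    have t3 : Tendsto (fun e => e * a * star e) l (𝓝 a) := by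
      have t4 : Tendsto (fun e => (e * a - a) * star e) l (𝓝 0) := by
        rw [tendsto_zero_iff_norm_tendsto_zero]
        have t5 := (tendsto_iff_norm_sub_tendsto_zero.1 t1)
        refine squeeze_zero' (Eventually.of_forall fun _ => norm_nonneg _) ?_ t5
        filter_upwards [hl1] with e he
        refine (norm_mul_le _ _).trans (mul_le_of_le_one_right (norm_nonneg _) ?_)
        rw [norm_star]; exact he.2
      have := t4.add t2
      simpa [sub_mul] using this
    have hcl := isClosed_clsp {x | ∃ m₁ ∈ M, ∃ m₂ ∈ M, ∃ b ∈ (B ∩ {y | ∃ b ∈ B, y = star b}), x = (adjoint m₁) ∘L (b ∘L m₂)}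
    refine (mem_clsp _ _).1 (hcl.mem_of_tendsto t3 ?_)
    filter_upwards [hl1] with e he
    have he1 : e ∈ clsp (troSet M) := he.1
    have he2 : star e ∈ clsp (troSet M) := (troAlg M hT).star_mem' he.1
    refine clsp_map hcl ((ContinuousLinearMap.mul ℂ (H →L[ℂ] H)) (e * a)) (fun y hy => ?_) _ he2
    refine clsp_map hcl ((ContinuousLinearMap.mul ℂ (H →L[ℂ] H)).flip (a * y))
      (fun x hx => ?_) e he1 |> fun h => by simpa [mul_assoc] using h
    obtain ⟨m, hm, n, hn, rfl⟩ := hx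
    obtain ⟨p, hp, q, hq, rfl⟩ := hy
    refine subset_clsp _ ⟨m, hm, q, hq, n ∘L (a ∘L adjoint p), ⟨hBA n hn p hp a haA,
      p ∘L (a' ∘L adjoint n), hBA p hp n hn a' ha', ?_⟩, rfl⟩
    rw [haa, star_eq_adjoint, star_eq_adjoint, adjoint_comp, adjoint_comp, adjoint_adjoint]
    rfl
  · intro x hx
    have hx' := (mem_clsp _ _).2 hx
    have hAc : A = (clsp {x | ∃ m₁ ∈ M, ∃ m₂ ∈ M, ∃ b ∈ B, x = (adjoint m₁) ∘L (b ∘L m₂)} : Set _) := by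
      rw [coe_clsp]; exact hAB
    refine ⟨?_, star x, ?_, (star_star x).symm⟩
    · rw [hAc]
      refine clsp_map (isClosed_clsp _) (ContinuousLinearMap.id ℂ _) ?_ x hx'
      rintro y ⟨m, hm, n, hn, b, hb, rfl⟩
      exact subset_clsp _ ⟨m, hm, n, hn, b, hb.1, rfl⟩
    · rw [hAc]
      refine clsp_star (isClosed_clsp _) ?_ x hx'
      rintro y ⟨m, hm, n, hn, b, ⟨hb, b', hb', rfl⟩, rfl⟩
      refine subset_clsp _ ⟨n, hn, m, hm, b', hb', ?_⟩
      rw [star_eq_adjoint, star_eq_adjoint, adjoint_comp, adjoint_comp, adjoint_adjoint,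
        adjoint_adjoint]
      rfl

lemma conjTRO'_eq (M : Set (H →L[ℂ] K)) (A : Set (H →L[ℂ] H)) :
    conjTRO' M A = conjTRO {x | adjoint x ∈ M} A := by
  unfold conjTRO' conjTRO
  congr 1
  ext x
  constructor
  · rintro ⟨m, hm, n, hn, a, ha, rfl⟩
    exact ⟨adjoint m, by simpa using hm, adjoint n, by simpa using hn, a, ha, by simp⟩
  · rintro ⟨m, hm, n, hn, a, ha, rfl⟩
    exact ⟨_, hm, _, hn, a, ha, by simp⟩

/-- Strong TRO equivalence passes to diagonals: if `A = [M* B M]` and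
`B = [M A M*]`, then `Δ(A) = [M* Δ(B) M]` and `Δ(B) = [M Δ(A) M*]`. -/
theorem strongTRO_diagonals
    (A : Set (H →L[ℂ] H)) (B : Set (K →L[ℂ] K))
    (hA : IsClosedSubalgebra A) (hB : IsClosedSubalgebra B)
    (M : Set (H →L[ℂ] K)) (hM : IsTRO M)
    (hAB : A = conjTRO M B) (hBA : B = conjTRO' M A) :
    A ∩ {x | ∃ a ∈ A, x = star a} =
        conjTRO M (B ∩ {y | ∃ b ∈ B, y = star b}) ∧
      B ∩ {y | ∃ b ∈ B, y = star b} =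
        conjTRO' M (A ∩ {x | ∃ a ∈ A, x = star a}) := by
  refine ⟨diag_core A B M hM.2 hAB ?_, ?_⟩
  · intro m hm n hn a ha
    rw [hBA]
    exact (mem_clsp _ _).1 (subset_clsp _ ⟨m, hm, n, hn, a, ha, rfl⟩)
  · rw [conjTRO'_eq]
    refine diag_core B A _ ?_ (by rw [← conjTRO'_eq]; exact hBA) ?_
    · intro m hm n hn p hp
      have := hM.2 _ hp _ hn _ hm
      simpa [adjoint_comp, comp_assoc] using this
    · intro m hm n hn b hb
      rw [hAB]
      exact (mem_clsp _ _).1 (subset_clsp _ ⟨_, hm, _, hn, b, hb, by simp⟩)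
end
end

section
/- Let H be a complex Hilbert space and A ⊆ B(H) a norm-closed subalgebra possessing a countable approximate identity, i.e. a sequence (e_n) in A with ‖e_n a − a‖ → 0 and ‖a e_n − a‖ → 0 for every a ∈ A. Let D ⊆ B(H) be the norm-closed linear span of all finite products of the form a₁* b₁ a₂* b₂ ⋯ a_k* b_k with k ≥ 1 and a_i, b_i ∈ A (so D is a C*-subalgebra of B(H)). Then there exists a positive element a₀ ∈ D such that D equals the norm closure of {d a₀ : d ∈ D}. -/
noncomputable section

open ContinuousLinearMap

variable {H K L R : Type*}
  [NormedAddCommGroup H] [InnerProductSpace ℂ H] [CompleteSpace H]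
  [NormedAddCommGroup K] [InnerProductSpace ℂ K] [CompleteSpace K]
  [NormedAddCommGroup L] [InnerProductSpace ℂ L] [CompleteSpace L]
  [NormedAddCommGroup R] [InnerProductSpace ℂ R] [CompleteSpace R]

open Filter Topology in
lemma spe_norm_bound {B : Type*} [CStarAlgebra B] [PartialOrder B] [StarOrderedRing B]
    (c : B) (h0 : 0 ≤ c) (h1 : ‖c‖ ≤ 1) (k : ℕ) (hk : 0 < k) :
    ‖(1 - c) ^ k * c * (1 - c) ^ k‖ ≤ 1 / k := by
  have hsa : IsSelfAdjoint c := IsSelfAdjoint.of_nonneg h0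
  have hc : (1 - c) ^ k * c * (1 - c) ^ k
      = cfc (fun t : ℝ => (1 - t) ^ k * t * (1 - t) ^ k) c := by
    have e1 : cfc (fun t : ℝ => 1 - t) c = 1 - c := by
      rw [cfc_sub (fun _ : ℝ => (1:ℝ)) (fun t => t) c, cfc_const_one ℝ c, cfc_id' ℝ c]
    have e2 : cfc (fun t : ℝ => (1 - t) ^ k) c = (1 - c) ^ k := by
      rw [cfc_pow (fun t : ℝ => 1 - t) k c, e1]
    rw [cfc_mul (fun t : ℝ => (1 - t) ^ k * t) (fun t => (1 - t) ^ k) c,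
      cfc_mul (fun t : ℝ => (1 - t) ^ k) (fun t => t) c, e2, cfc_id' ℝ c]
  rw [hc]
  refine norm_cfc_le (by positivity) fun t ht => ?_
  have t0 : 0 ≤ t := spectrum_nonneg_of_nonneg h0 ht
  have t1 : t ≤ 1 := by
    have hn : Nontrivial B := by
      by_contra hB
      rw [not_nontrivial_iff_subsingleton] at hB
      simp [spectrum.of_subsingleton] at ht
    have := spectrum.norm_le_norm_of_mem ht
    exact (le_abs_self t).trans (this.trans h1)
  have u0 : 0 ≤ 1 - t := by linarith
  have u1 : (1 - t) ^ k ≤ 1 := pow_le_one₀ u0 (by linarith)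
  have up : 0 ≤ (1 - t) ^ k := pow_nonneg u0 k
  rw [Real.norm_of_nonneg (by positivity), le_div_iff₀ (by exact_mod_cast hk)]
  have b1 : 1 + (k:ℝ) * t ≤ (1 + t) ^ k := one_add_mul_le_pow (by linarith) k
  have b2 : (1 + t) ^ k * (1 - t) ^ k ≤ 1 := by
    rw [← mul_pow]
    exact pow_le_one₀ (by nlinarith) (by nlinarith)
  have b3 : t * (1 - t) ^ k * k ≤ 1 := by nlinarith
  have b4 : 0 ≤ t * (1 - t) ^ k * k := by positivity
  calc (1 - t) ^ k * t * (1 - t) ^ k * k = (1 - t) ^ k * (t * (1 - t) ^ k * k) := by ring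
    _ ≤ 1 * 1 := by gcongr
    _ = 1 := by ring

open Filter Topology in
lemma spe_tendsto {B : Type*} [CStarAlgebra B] [PartialOrder B] [StarOrderedRing B]
    (c : B) (h0 : 0 ≤ c) (h1 : ‖c‖ ≤ 1) (x : B) (M : ℝ) (hM : 0 ≤ M)
    (hx : star x * x ≤ M • c) :
    Tendsto (fun k : ℕ => x * (1 - c) ^ k) atTop (𝓝 0) := by
  have hsa : IsSelfAdjoint c := IsSelfAdjoint.of_nonneg h0
  have key : ∀ k : ℕ, 0 < k → ‖x * (1 - c) ^ k‖ ^ 2 ≤ M * (1 / k) := by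
    intro k hk
    have hu : star ((1 - c) ^ k) = (1 - c) ^ k := by simp [hsa.star_eq]
    have h2 : star (x * (1 - c) ^ k) * (x * (1 - c) ^ k)
        ≤ M • ((1 - c) ^ k * c * (1 - c) ^ k) := by
      have := star_left_conjugate_le_conjugate hx ((1 - c) ^ k)
      rw [hu] at this
      rw [star_mul, hu]
      simpa [mul_assoc] using this
    rw [sq, ← CStarRing.norm_star_mul_self]
    calc _ ≤ ‖M • ((1 - c) ^ k * c * (1 - c) ^ k)‖ :=
          CStarAlgebra.norm_le_norm_of_nonneg_of_le (star_mul_self_nonneg _) h2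
      _ ≤ M * (1 / k) := by
          rw [norm_smul, Real.norm_of_nonneg hM]
          gcongr
          exact spe_norm_bound c h0 h1 k hk
  have h3 : Tendsto (fun k : ℕ => ‖x * (1 - c) ^ k‖ ^ 2) atTop (𝓝 0) := by
    have hz : Tendsto (fun k : ℕ => M * (1 / (k:ℝ))) atTop (𝓝 0) := by
      simpa using (tendsto_one_div_atTop_nhds_zero_nat (𝕜 := ℝ)).const_mul M
    refine squeeze_zero' (Eventually.of_forall fun k => by positivity) ?_ hz
    filter_upwards [eventually_gt_atTop 0] with k hk using key k hk
  rw [tendsto_zero_iff_norm_tendsto_zero]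
  have := h3.sqrt
  simpa using this

lemma spe_one_sub_norm {B : Type*} [CStarAlgebra B] [PartialOrder B] [StarOrderedRing B]
    (c : B) (h0 : 0 ≤ c) (h1 : ‖c‖ ≤ 1) : ‖1 - c‖ ≤ 1 := by
  have hc : c ≤ 1 := (CStarAlgebra.norm_le_one_iff_of_nonneg c h0).1 h1
  exact (CStarAlgebra.norm_le_one_iff_of_nonneg _ (sub_nonneg.2 hc)).2 (by simpa using h0)

open Filter Topology in
lemma spe_closed {B : Type*} [CStarAlgebra B] (u : B) (hu : ‖u‖ ≤ 1) :
    IsClosed {x : B | Tendsto (fun k : ℕ => x * u ^ k) atTop (𝓝 0)} := by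
  rw [← isSeqClosed_iff_isClosed]
  intro y x hy hyx
  have hpow : ∀ k : ℕ, ‖u ^ (k + 1)‖ ≤ 1 := fun k =>
    (norm_pow_le' u k.succ_pos).trans (pow_le_one₀ (norm_nonneg _) hu)
  simp only [Set.mem_setOf_eq] at hy ⊢
  rw [Metric.tendsto_atTop] at hyx ⊢
  intro ε hε
  obtain ⟨N, hN⟩ := hyx (ε / 2) (by positivity)
  obtain ⟨K, hK⟩ := Metric.tendsto_atTop.1 (hy N) (ε / 2) (by positivity)
  refine ⟨K + 1, fun k hk => ?_⟩
  have a1 := hN N le_rfl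
  have a2 := hK k (by omega)
  obtain ⟨j, rfl⟩ : ∃ j, k = j + 1 := ⟨k - 1, by omega⟩
  rw [dist_eq_norm, sub_zero] at a2 ⊢
  rw [dist_comm, dist_eq_norm] at a1
  have : x * u ^ (j+1) = (x - y N) * u ^ (j+1) + y N * u ^ (j+1) := by noncomm_ring
  rw [this]
  have h3 : ‖(x - y N) * u ^ (j+1)‖ ≤ ‖x - y N‖ * 1 :=
    (norm_mul_le _ _).trans (by gcongr; exact hpow j)
  have h4 := norm_add_le ((x - y N) * u ^ (j+1)) (y N * u ^ (j+1))
  linarith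

/-- If `A ⊆ B(H)` is a norm-closed subalgebra with a countable approximate
identity and `D` is the norm-closed linear span of all products `a₁* b₁ a₂* b₂ ⋯ a_k* b_k`
with entries in `A`, then `D` contains a positive element `a₀` with `D = closure (D a₀)`. -/
theorem strictly_positive_element
    (A : Set (H →L[ℂ] H)) (hA : IsClosedSubalgebra A) (hai : HasCountableAI A)
    (D : Set (H →L[ℂ] H))
    (hD : D = clspan {x | ∃ k : ℕ, 0 < k ∧ ∃ a b : Fin k → (H →L[ℂ] H),
      (∀ i, a i ∈ A) ∧ (∀ i, b i ∈ A) ∧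
      x = (List.ofFn fun i => star (a i) * b i).prod}) :
    ∃ a₀ ∈ D, (∃ c ∈ D, a₀ = star c * c) ∧
      D = closure {x | ∃ d ∈ D, x = d * a₀} := by
  obtain ⟨e, heA, he⟩ := hai
  set S : Set (H →L[ℂ] H) := {x | ∃ k : ℕ, 0 < k ∧ ∃ a b : Fin k → (H →L[ℂ] H),
      (∀ i, a i ∈ A) ∧ (∀ i, b i ∈ A) ∧
      x = (List.ofFn fun i => star (a i) * b i).prod} with hS
  set P : Submodule ℂ (H →L[ℂ] H) := (Submodule.span ℂ S).topologicalClosure with hP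
  have hDP : D = (P : Set (H →L[ℂ] H)) := by
    rw [hD, hP, clspan, Submodule.topologicalClosure_coe]
  have hPc : IsClosed (P : Set (H →L[ℂ] H)) := Submodule.isClosed_topologicalClosure _
  have hSS : ∀ x ∈ S, ∀ y ∈ S, x * y ∈ S := by
    rintro x ⟨k, hk, a, b, ha, hb, rfl⟩ y ⟨l, hl, a', b', ha', hb', rfl⟩
    refine ⟨k + l, by omega, Fin.append a a', Fin.append b b', ?_, ?_, ?_⟩
    · intro i
      refine Fin.addCases (fun i => ?_) (fun i => ?_) i <;> simp [ha, ha']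
    · intro i
      refine Fin.addCases (fun i => ?_) (fun i => ?_) i <;> simp [hb, hb']
    · rw [← List.prod_append, List.ofFn_add]
      simp
  have hspan : ∀ x ∈ Submodule.span ℂ S, ∀ y ∈ Submodule.span ℂ S,
      x * y ∈ Submodule.span ℂ S := by
    intro x hx y hy
    have h := Submodule.mul_mem_mul hx hy
    rw [Submodule.span_mul_span] at h
    refine Submodule.span_mono ?_ h
    rintro _ ⟨x, hx, y, hy, rfl⟩
    exact hSS x hx y hy
  have hmul : ∀ x ∈ P, ∀ y ∈ P, x * y ∈ P := by
    intro x hx y hy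
    exact map_mem_closure₂ continuous_mul hx hy hspan
  have heS : ∀ n, star (e n) * e n ∈ P := by
    intro n
    refine Submodule.le_topologicalClosure _ (Submodule.subset_span ?_)
    exact ⟨1, one_pos, fun _ => e n, fun _ => e n, fun _ => heA n, fun _ => heA n, by simp⟩
  -- the element c
  set w : ℕ → ℝ := fun n => (1 / 2 / 2 ^ n) / (1 + ‖star (e n) * e n‖) with hw
  have hwpos : ∀ n, 0 < w n := fun n => by positivity
  set f : ℕ → (H →L[ℂ] H) := fun n => w n • (star (e n) * e n) with hf
  have hf0 : ∀ n, 0 ≤ f n := fun n => smul_nonneg (hwpos n).le (star_mul_self_nonneg _)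
  have hfn : ∀ n, ‖f n‖ ≤ 1 / 2 / 2 ^ n := by
    intro n
    rw [hf, norm_smul, Real.norm_of_nonneg (hwpos n).le, hw]
    simp only
    rw [div_mul_eq_mul_div, div_le_iff₀ (by positivity)]
    gcongr
    linarith
  have hgeo : HasSum (fun n : ℕ => (1:ℝ) / 2 / 2 ^ n) 1 := hasSum_geometric_two' 1
  have hsum : Summable f := Summable.of_norm_bounded hgeo.summable hfn
  set c := ∑' n, f n with hc
  have hc0 : 0 ≤ c := tsum_nonneg hf0
  have hc1 : ‖c‖ ≤ 1 := tsum_of_norm_bounded hgeo hfn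
  have hfP : ∀ n, f n ∈ P := by
    intro n
    have := P.smul_mem ((w n : ℝ) : ℂ) (heS n)
    simpa [hf] using this
  have hcP : c ∈ P :=
    hPc.mem_of_tendsto hsum.hasSum (Filter.Eventually.of_forall fun s => P.sum_mem fun n _ => hfP n)
  have hsa : IsSelfAdjoint c := IsSelfAdjoint.of_nonneg hc0
  have hu : ‖1 - c‖ ≤ 1 := spe_one_sub_norm c hc0 hc1
  set Z : Set (H →L[ℂ] H) :=
    {x | Filter.Tendsto (fun k : ℕ => x * (1 - c) ^ k) Filter.atTop (nhds 0)} with hZ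
  have hZc : IsClosed Z := spe_closed _ hu
  have hZmul : ∀ y, ∀ x ∈ Z, y * x ∈ Z := by
    intro y x hx
    have := Filter.Tendsto.const_mul y hx
    simpa [hZ, mul_assoc] using this
  have heZ : ∀ n, e n ∈ Z := by
    intro n
    refine spe_tendsto c hc0 hc1 (e n) (w n)⁻¹ (inv_nonneg.2 (hwpos n).le) ?_
    have h : f n ≤ c := hsum.le_tsum n fun j _ => hf0 j
    have h2 := smul_le_smul_of_nonneg_left h (inv_nonneg.2 (hwpos n).le)
    rwa [hf, smul_smul, inv_mul_cancel₀ (hwpos n).ne', one_smul] at h2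
  have hAZ : ∀ b ∈ A, b ∈ Z := by
    intro b hb
    have h := tendsto_iff_norm_sub_tendsto_zero.2 (he b hb).2
    exact hZc.mem_of_tendsto h (Filter.Eventually.of_forall fun n => hZmul _ _ (heZ n))
  have hSZ : S ⊆ Z := by
    rintro x ⟨k, hk, a, b, ha, hb, rfl⟩
    obtain ⟨j, rfl⟩ : ∃ j, k = j + 1 := ⟨k - 1, by omega⟩
    rw [List.ofFn_succ', List.prod_concat, ← mul_assoc]
    exact hZmul _ _ (hAZ _ (hb _))
  have hspZ : (Submodule.span ℂ S : Set (H →L[ℂ] H)) ⊆ Z := by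
    intro x hx
    induction hx using Submodule.span_induction with
    | mem x h => exact hSZ h
    | zero => simp [hZ]
    | add x y _ _ hx hy =>
      have := Filter.Tendsto.add hx hy
      simpa [hZ, add_mul] using this
    | smul r x _ hx =>
      have := Filter.Tendsto.const_smul hx r
      simpa [hZ] using this
  have hPZ : (P : Set (H →L[ℂ] H)) ⊆ Z := closure_minimal hspZ hZc
  have hrep : ∀ d ∈ P, ∀ k : ℕ, ∃ q ∈ P, d - d * (1 - c) ^ k = q * c := by
    intro d hd k
    induction k with
    | zero => exact ⟨0, P.zero_mem, by simp⟩
    | succ k ih =>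
      obtain ⟨q, hq, h⟩ := ih
      refine ⟨d - q * c + q, P.add_mem (P.sub_mem hd (hmul _ hq _ hcP)) hq, ?_⟩
      have h' : d * (1 - c) ^ k = d - q * c := by rw [← h]; abel
      rw [pow_succ, ← mul_assoc, h']
      noncomm_ring
  have happ : ∀ d ∈ P, ∀ ε > 0, ∃ q ∈ P, ‖d - q * c‖ < ε := by
    intro d hd ε hε
    obtain ⟨N, hN⟩ := Metric.tendsto_atTop.1 (hPZ hd) ε hε
    obtain ⟨q, hq, h⟩ := hrep d hd N
    refine ⟨q, hq, ?_⟩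
    have := hN N le_rfl
    rw [dist_zero_right] at this
    rwa [← h, sub_sub_cancel]
  refine ⟨star c * c, ?_, ⟨c, ?_, rfl⟩, ?_⟩
  · rw [hDP, hsa.star_eq]; exact hmul _ hcP _ hcP
  · rw [hDP]; exact hcP
  · rw [hDP, hsa.star_eq]
    apply Set.Subset.antisymm
    · intro d hd
      rw [Metric.mem_closure_iff]
      intro ε hε
      obtain ⟨q, hq, h1⟩ := happ d hd (ε / 2) (by positivity)
      obtain ⟨r, hr, h2⟩ := happ q hq (ε / 2) (by positivity)
      refine ⟨r * (c * c), ⟨r, hr, rfl⟩, ?_⟩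
      rw [dist_eq_norm]
      have e1 : d - r * (c * c) = (d - q * c) + (q - r * c) * c := by noncomm_ring
      rw [e1]
      have e2 := norm_add_le (d - q * c) ((q - r * c) * c)
      have e3 : ‖(q - r * c) * c‖ ≤ ‖q - r * c‖ * 1 :=
        (norm_mul_le _ _).trans (by gcongr)
      linarith
    · refine closure_minimal ?_ hPc
      rintro x ⟨d, hd, rfl⟩
      exact hmul _ hd _ (hmul _ hcP _ hcP)
end
end

section
/- Let H, K be complex Hilbert spaces, let A ⊆ B(H) and B ⊆ B(K) be norm-closed subalgebras acting nondegenerately (the spans of A(H) and of B(K) are dense in H and K respectively), and let M ⊆ B(H,K) be a TRO with A = [M*BM] and B = [MAM*]. Assume A possesses a countable approximate identity, i.e. a sequence (e_n) in A with ‖e_n a − a‖ → 0 and ‖a e_n − a‖ → 0 for every a ∈ A. Then there exists a sequence (m_i)_{i∈ℕ} in M such that ‖Σ_{i=1}^{k} m_i* m_i‖ ≤ 1 for every k ∈ ℕ, and for every a ∈ A, ‖a (Σ_{i=1}^{k} m_i* m_i) − a‖ → 0 as k → ∞. -/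
noncomputable section

open ContinuousLinearMap

variable {H K L R : Type*}
  [NormedAddCommGroup H] [InnerProductSpace ℂ H] [CompleteSpace H]
  [NormedAddCommGroup K] [InnerProductSpace ℂ K] [CompleteSpace K]
  [NormedAddCommGroup L] [InnerProductSpace ℂ L] [CompleteSpace L]
  [NormedAddCommGroup R] [InnerProductSpace ℂ R] [CompleteSpace R]

lemma tro_cfc_mem (p : Submodule ℂ (H →L[ℂ] K)) (hp : IsClosed (p : Set (H →L[ℂ] K)))
    (y : K →L[ℂ] K) (hy : IsSelfAdjoint y) (hyp : ∀ x ∈ p, y ∘L x ∈ p) (f : ℝ → ℝ)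
    (x : H →L[ℂ] K) (hx : x ∈ p) : (cfc f y) ∘L x ∈ p := by
  let N : StarSubalgebra ℝ (K →L[ℂ] K) :=
    { carrier := {b | (∀ x ∈ p, b ∘L x ∈ p) ∧ (∀ x ∈ p, (star b) ∘L x ∈ p)}
      mul_mem' := by
        rintro a b ⟨ha, ha'⟩ ⟨hb, hb'⟩
        have e1 : ∀ (u v : K →L[ℂ] K) (x : H →L[ℂ] K), (u * v) ∘L x = u ∘L (v ∘L x) :=
          fun u v x => rfl
        refine ⟨fun x hx => ?_, fun x hx => ?_⟩
        · rw [e1]; exact ha _ (hb x hx)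
        · rw [star_mul, e1]; exact hb' _ (ha' x hx)
      add_mem' := by
        rintro a b ⟨ha, ha'⟩ ⟨hb, hb'⟩
        refine ⟨fun x hx => ?_, fun x hx => ?_⟩
        · rw [add_comp]; exact p.add_mem (ha x hx) (hb x hx)
        · rw [star_add, add_comp]; exact p.add_mem (ha' x hx) (hb' x hx)
      algebraMap_mem' := by
        intro r
        have key : ∀ x ∈ p, (algebraMap ℝ (K →L[ℂ] K) r) ∘L x ∈ p := by
          intro x hx
          have : (algebraMap ℝ (K →L[ℂ] K) r) ∘L x = (r : ℂ) • x := by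
            ext v
            simp [Algebra.algebraMap_eq_smul_one]
          rw [this]; exact p.smul_mem _ hx
        refine ⟨key, ?_⟩
        have : star (algebraMap ℝ (K →L[ℂ] K) r) = algebraMap ℝ (K →L[ℂ] K) r := by
          simp [Algebra.algebraMap_eq_smul_one]
        rw [this]; exact key
      star_mem' := by
        rintro a ⟨ha, ha'⟩
        exact ⟨ha', by simpa using ha⟩ }
  have hN : IsClosed (N : Set (K →L[ℂ] K)) := by
    have : (N : Set (K →L[ℂ] K)) = (⋂ x ∈ p, {b | b ∘L x ∈ p}) ∩
        (⋂ x ∈ p, {b | (star b) ∘L x ∈ p}) := by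
      ext b
      simp only [Set.mem_inter_iff, Set.mem_iInter]
      rfl
    rw [this]
    refine IsClosed.inter ?_ ?_
    · refine isClosed_biInter fun x _ => ?_
      exact hp.preimage (f := fun b : K →L[ℂ] K => b ∘L x) (by fun_prop)
    · refine isClosed_biInter fun x _ => ?_
      exact hp.preimage (f := fun b : K →L[ℂ] K => (star b) ∘L x)
        ((by fun_prop : Continuous fun b : K →L[ℂ] K => b ∘L x).comp continuous_star)
  have hyN : y ∈ N := ⟨hyp, by rw [hy.star_eq]; exact hyp⟩
  have := StarAlgebra.elemental.le_of_mem hN hyN (cfc_mem_elemental f y)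
  exact this.1 x hx

lemma conj_norm_mono (q : H →L[ℂ] K) {s t : H →L[ℂ] H} (hs : 0 ≤ s) (hst : s ≤ t) :
    ‖q ∘L (s ∘L adjoint q)‖ ≤ ‖q ∘L (t ∘L adjoint q)‖ := by
  have key : ∀ u : H →L[ℂ] H, 0 ≤ u → 0 ≤ q ∘L (u ∘L adjoint q) := fun u hu => by
    rw [nonneg_iff_isPositive] at hu ⊢
    exact hu.conj_adjoint q
  refine CStarAlgebra.norm_le_norm_of_nonneg_of_le (key s hs) ?_
  rw [← sub_nonneg]
  have := key (t - s) (sub_nonneg.2 hst)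
  rwa [sub_comp, comp_sub] at this

lemma sqrt_facts {t : H →L[ℂ] H} (ht : 0 ≤ t) :
    ∃ r : H →L[ℂ] H, adjoint r = r ∧ r ∘L r = t := by
  refine ⟨CFC.sqrt t, ?_, CFC.sqrt_mul_sqrt_self t ht⟩
  exact (CFC.sqrt_nonneg t).isSelfAdjoint.star_eq

lemma norm_comp_adj (w : H →L[ℂ] K) : ‖w ∘L adjoint w‖ = ‖w‖ * ‖w‖ := by
  have := norm_adjoint_comp_self (adjoint w)
  simpa using this

lemma norm_sq_le (q : H →L[ℂ] K) {t : H →L[ℂ] H} (ht : 0 ≤ t) (ht1 : t ≤ 1) :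
    ‖q ∘L t‖ * ‖q ∘L t‖ ≤ ‖q ∘L (t ∘L adjoint q)‖ := by
  obtain ⟨r, hr, hrr⟩ := sqrt_facts ht
  have h1 : ‖r‖ ≤ 1 := by
    have h := norm_comp_adj r
    rw [hr, hrr] at h
    have := (CStarAlgebra.norm_le_one_iff_of_nonneg t ht).2 ht1
    nlinarith [norm_nonneg r]
  have h2 : ‖q ∘L (t ∘L adjoint q)‖ = ‖q ∘L r‖ * ‖q ∘L r‖ := by
    rw [← norm_comp_adj, adjoint_comp, hr, ← hrr]; rfl
  have h3 : ‖q ∘L t‖ ≤ ‖q ∘L r‖ := by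
    rw [← hrr, ← comp_assoc]
    calc _ ≤ ‖q ∘L r‖ * ‖r‖ := opNorm_comp_le _ _
      _ ≤ ‖q ∘L r‖ * 1 := by gcongr
      _ = _ := mul_one _
  rw [h2]
  gcongr

lemma step_exists (p : Submodule ℂ (H →L[ℂ] K)) (hp : IsClosed (p : Set (H →L[ℂ] K)))
    (hT : ∀ m₁ ∈ p, ∀ m₂ ∈ p, ∀ m₃ ∈ p, m₁ ∘L ((adjoint m₂) ∘L m₃) ∈ p)
    (t : H →L[ℂ] H) (ht : 0 ≤ t) (htp : ∀ x ∈ p, x ∘L t ∈ p)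
    (q : H →L[ℂ] K) (hq : q ∈ p) (ε : ℝ) (hε : 0 < ε) :
    ∃ m ∈ p, 0 ≤ t - (adjoint m) ∘L m ∧
      ‖q ∘L ((t - (adjoint m) ∘L m) ∘L adjoint q)‖ ≤ ε := by
  obtain ⟨r, hr, hrr⟩ := sqrt_facts ht
  set w := q ∘L r with hw
  have hwa : adjoint w = r ∘L adjoint q := by rw [hw, adjoint_comp, hr]
  set y := w ∘L adjoint w with hy
  have hyq : y = (q ∘L t) ∘L adjoint q := by
    rw [hy, hwa, ← hrr]; rfl
  have hypos : 0 ≤ y := by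
    rw [nonneg_iff_isPositive, hy]
    exact isPositive_self_comp_adjoint w
  have hysa : IsSelfAdjoint y := hypos.isSelfAdjoint
  have hyp : ∀ x ∈ p, y ∘L x ∈ p := fun x hx => by
    rw [hyq]
    exact hT _ (htp q hq) _ hq _ hx
  let f : ℝ → ℝ := fun x => (Real.sqrt (|x| + ε))⁻¹
  have hf : Continuous f := by
    refine Continuous.inv₀ (by fun_prop) fun x => ?_
    have : 0 < |x| + ε := by positivity
    positivity
  have hff : ∀ x, f x * f x = (|x| + ε)⁻¹ := fun x => by
    have : 0 ≤ |x| + ε := by positivity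
    simp only [f]
    rw [← mul_inv, Real.mul_self_sqrt this]
  set g := cfc f y with hg
  have hga : adjoint g = g := (cfc_predicate f y : IsSelfAdjoint _).star_eq
  have hspec : ∀ x ∈ spectrum ℝ y, 0 ≤ x := fun x hx => spectrum_nonneg_of_nonneg hypos hx
  set z := g ∘L w with hz
  have hza : adjoint z = adjoint w ∘L g := by rw [hz, adjoint_comp, hga]
  have hid : cfc (fun x : ℝ => x) y = y := cfc_id' ℝ y
  have hgyg : g * y * g = cfc (fun x => f x * x * f x) y := by
    rw [cfc_mul (fun x => f x * x) f y (by fun_prop) (by fun_prop),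
      cfc_mul f (fun x => x) y (by fun_prop) (by fun_prop), hid]
  have hygy : y - y * g * g * y = cfc (fun x => x - x * f x * f x * x) y := by
    rw [cfc_sub (fun x => x) (fun x => x * f x * f x * x) y (by fun_prop) (by fun_prop),
      cfc_mul (fun x => x * f x * f x) (fun x => x) y (by fun_prop) (by fun_prop),
      cfc_mul (fun x => x * f x) f y (by fun_prop) (by fun_prop),
      cfc_mul (fun x => x) f y (by fun_prop) (by fun_prop), hid]
  have hz1 : ‖z‖ ≤ 1 := by
    have h1 : z ∘L adjoint z = g * y * g := by rw [hza, hz, hy]; rfl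
    have h2 := norm_comp_adj z
    have h3 : ‖g * y * g‖ ≤ 1 := by
      rw [hgyg]
      refine norm_cfc_le zero_le_one fun x hx => ?_
      have hx0 := hspec x hx
      have : f x * x * f x = x / (x + ε) := by
        rw [mul_right_comm, hff, abs_of_nonneg hx0]; field_simp
      rw [this, Real.norm_of_nonneg (by positivity), div_le_one (by positivity)]
      linarith
    rw [h1] at h2
    nlinarith [norm_nonneg z]
  refine ⟨z ∘L r, ?_, ?_, ?_⟩
  · have : z ∘L r = g ∘L (q ∘L t) := by rw [hz, hw, ← hrr]; rfl
    rw [this]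
    exact tro_cfc_mem p hp y hysa hyp f _ (htp q hq)
  · have h1 : t - adjoint (z ∘L r) ∘L (z ∘L r) =
        r ∘L ((1 - adjoint z ∘L z) ∘L adjoint r) := by
      rw [sub_comp, comp_sub, adjoint_comp, hr, ← hrr]; rfl
    rw [h1, nonneg_iff_isPositive]
    refine IsPositive.conj_adjoint ?_ r
    rw [← nonneg_iff_isPositive, sub_nonneg]
    have hzz : 0 ≤ adjoint z ∘L z := by
      rw [nonneg_iff_isPositive]; exact isPositive_adjoint_comp_self z
    rw [← CStarAlgebra.norm_le_one_iff_of_nonneg _ hzz, norm_adjoint_comp_self]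
    nlinarith [norm_nonneg z]
  · have h1 : q ∘L ((t - adjoint (z ∘L r) ∘L (z ∘L r)) ∘L adjoint q) =
        y - y * g * g * y := by
      rw [sub_comp, comp_sub, adjoint_comp, hr, hza, hz, hyq, ← hrr, hwa, hw]; rfl
    rw [h1, hygy]
    refine norm_cfc_le hε.le fun x hx => ?_
    have hx0 := hspec x hx
    have : x - x * f x * f x * x = ε * (x / (x + ε)) := by
      rw [mul_assoc x, hff, abs_of_nonneg hx0]; field_simp; ring
    rw [this, Real.norm_of_nonneg (by positivity)]
    have : x / (x + ε) ≤ 1 := by rw [div_le_one (by positivity)]; linarith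
    nlinarith

lemma tendsto_closure (t : ℕ → (H →L[ℂ] H)) (ht : ∀ k, ‖t k‖ ≤ 1) (e : H →L[ℂ] H)
    (h : ∀ ε > 0, ∃ y : H →L[ℂ] H, ‖e - y‖ ≤ ε ∧
      Filter.Tendsto (fun k => ‖y * t k‖) Filter.atTop (nhds 0)) :
    Filter.Tendsto (fun k => ‖e * t k‖) Filter.atTop (nhds 0) := by
  rw [Metric.tendsto_atTop]
  intro ε hε
  obtain ⟨y, hy, hyt⟩ := h (ε / 2) (by positivity)
  rw [Metric.tendsto_atTop] at hyt
  obtain ⟨N, hN⟩ := hyt (ε / 2) (by positivity)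
  refine ⟨N, fun n hn => ?_⟩
  have h1 := hN n hn
  simp only [dist_zero_right, norm_norm] at h1 ⊢
  have h2 : e * t n = (e - y) * t n + y * t n := by noncomm_ring
  have h3 : ‖(e - y) * t n‖ ≤ ε / 2 := by
    calc _ ≤ ‖e - y‖ * ‖t n‖ := norm_mul_le _ _
      _ ≤ ε / 2 * 1 := by gcongr; exact ht n
      _ = _ := mul_one _
  rw [h2]
  linarith [norm_add_le ((e - y) * t n) (y * t n)]

lemma countable_test (M : Set (H →L[ℂ] K)) (B : Set (K →L[ℂ] K)) (e : H →L[ℂ] H)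
    (he : e ∈ conjTRO M B) :
    ∃ Q : Set (H →L[ℂ] K), Q.Countable ∧ Q ⊆ M ∧ ∀ t : ℕ → (H →L[ℂ] H), (∀ k, ‖t k‖ ≤ 1) →
      (∀ q ∈ Q, Filter.Tendsto (fun k => ‖q ∘L t k‖) Filter.atTop (nhds 0)) →
      Filter.Tendsto (fun k => ‖e * t k‖) Filter.atTop (nhds 0) := by
  have hspan : ∀ y ∈ Submodule.span ℂ
      {x : H →L[ℂ] H | ∃ m₁ ∈ M, ∃ m₂ ∈ M, ∃ b ∈ B, x = (adjoint m₁) ∘L (b ∘L m₂)},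
      ∃ Q : Set (H →L[ℂ] K), Q.Countable ∧ Q ⊆ M ∧ ∀ t : ℕ → (H →L[ℂ] H), 
      (∀ q ∈ Q, Filter.Tendsto (fun k => ‖q ∘L t k‖) Filter.atTop (nhds 0)) →
      Filter.Tendsto (fun k => ‖y * t k‖) Filter.atTop (nhds 0) := by
    intro y hy
    induction hy using Submodule.span_induction with
    | mem x hx =>
      obtain ⟨m₁, h₁, m₂, h₂, b, hb, rfl⟩ := hx
      refine ⟨{m₂}, Set.countable_singleton _, by simpa using h₂, fun t ht => ?_⟩
      have h := (ht m₂ rfl).const_mul ‖adjoint m₁ ∘L b‖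
      rw [mul_zero] at h
      exact squeeze_zero (fun _ => norm_nonneg _)
        (fun k => opNorm_comp_le (adjoint m₁ ∘L b) (m₂ ∘L t k)) h
    | zero => exact ⟨∅, Set.countable_empty, by simp, fun t _ => by simp⟩
    | add x y _ _ hx hy =>
      obtain ⟨Q, hQ, hQM, h⟩ := hx
      obtain ⟨Q', hQ', hQM', h'⟩ := hy
      refine ⟨Q ∪ Q', hQ.union hQ', Set.union_subset hQM hQM', fun t ht => ?_⟩
      have := (h t fun q hq => ht q (Or.inl hq)).add (h' t fun q hq => ht q (Or.inr hq))
      rw [add_zero] at this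
      refine squeeze_zero (fun _ => norm_nonneg _) (fun k => ?_) this
      rw [add_mul]; exact norm_add_le _ _
    | smul c x _ hx =>
      obtain ⟨Q, hQ, hQM, h⟩ := hx
      refine ⟨Q, hQ, hQM, fun t ht => ?_⟩
      have := (h t ht).const_mul ‖c‖
      rw [mul_zero] at this
      refine squeeze_zero (fun _ => norm_nonneg _) (fun k => ?_) this
      rw [smul_mul_assoc, norm_smul]
  have hcl : ∀ n : ℕ, ∃ y ∈ Submodule.span ℂ
      {x : H →L[ℂ] H | ∃ m₁ ∈ M, ∃ m₂ ∈ M, ∃ b ∈ B, x = (adjoint m₁) ∘L (b ∘L m₂)},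
      dist e y < 1 / ((n : ℝ) + 1) := fun n =>
    Metric.mem_closure_iff.1 he _ Nat.one_div_pos_of_nat
  choose y hy hye using hcl
  choose Q hQ hQM h using fun n => hspan (y n) (hy n)
  refine ⟨⋃ n, Q n, Set.countable_iUnion hQ, Set.iUnion_subset hQM, fun t ht htq => ?_⟩
  refine tendsto_closure t ht e fun ε hε => ?_
  obtain ⟨n, hn⟩ := exists_nat_one_div_lt hε
  refine ⟨y n, ?_, h n t fun q hq => htq q (Set.mem_iUnion.2 ⟨n, hq⟩)⟩
  rw [← dist_eq_norm]
  exact ((hye n).trans hn).le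

/-- If `A = [M* B M]`, `B = [M A M*]` for a TRO `M`, with `A`, `B`
nondegenerate and `A` possessing a countable approximate identity, then there is a sequence
`(mᵢ)` in `M` with `‖Σ_{i<k} mᵢ* mᵢ‖ ≤ 1` for every `k` and
`‖a (Σ_{i<k} mᵢ* mᵢ) - a‖ → 0` for every `a ∈ A`. -/
theorem sequence_in_TRO_approximate_identity
    (A : Set (H →L[ℂ] H)) (B : Set (K →L[ℂ] K))
    (hA : IsClosedSubalgebra A) (hB : IsClosedSubalgebra B)
    (hAnd : Nondegenerate A) (hBnd : Nondegenerate B)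
    (M : Set (H →L[ℂ] K)) (hM : IsTRO M)
    (hAB : A = conjTRO M B) (hBA : B = conjTRO' M A)
    (hai : HasCountableAI A) :
    ∃ m : ℕ → (H →L[ℂ] K), (∀ i, m i ∈ M) ∧
      (∀ k : ℕ, ‖∑ i ∈ Finset.range k, (adjoint (m i)) ∘L (m i)‖ ≤ 1) ∧
      ∀ a ∈ A, Filter.Tendsto
        (fun k => ‖a * (∑ i ∈ Finset.range k, (adjoint (m i)) ∘L (m i)) - a‖)
        Filter.atTop (nhds 0) := by
  obtain ⟨⟨hMc, p, rfl⟩, hT⟩ := hM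
  obtain ⟨e, heA, hai⟩ := hai
  choose Q₀ hQ₀ hQM h₀ using fun n => countable_test (p : Set (H →L[ℂ] K)) B (e n) (hAB ▸ heA n)
  obtain ⟨q, hq⟩ := ((Set.countable_iUnion hQ₀).insert (0 : H →L[ℂ] K)).exists_eq_range
    (Set.insert_nonempty _ _)
  have hqM : ∀ n, q n ∈ p := by
    intro n
    have : q n ∈ insert 0 (⋃ n, Q₀ n) := hq ▸ Set.mem_range_self n
    rcases this with h | h
    · rw [h]; exact p.zero_mem
    · obtain ⟨i, hi⟩ := Set.mem_iUnion.1 h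
      exact hQM i hi
  let X := {t : H →L[ℂ] H // 0 ≤ t ∧ ∀ x ∈ p, x ∘L t ∈ p}
  have hstep : ∀ (n : ℕ) (t : X), ∃ m ∈ p, 0 ≤ t.1 - (adjoint m) ∘L m ∧
      ‖q n.unpair.1 ∘L ((t.1 - (adjoint m) ∘L m) ∘L adjoint (q n.unpair.1))‖
        ≤ 1 / ((n : ℝ) + 1) :=
    fun n t => step_exists p hMc hT t.1 t.2.1 t.2.2 _ (hqM _) _ Nat.one_div_pos_of_nat
  choose F hFp hF0 hFn using hstep
  let T : ℕ → X := fun n => Nat.rec (motive := fun _ => X)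
    ⟨1, zero_le_one, fun x hx => hx⟩
    (fun n t => ⟨t.1 - (adjoint (F n t)) ∘L (F n t), hF0 n t, fun x hx => by
      rw [comp_sub]
      exact p.sub_mem (t.2.2 x hx) (hT _ hx _ (hFp n t) _ (hFp n t))⟩) n
  let m : ℕ → (H →L[ℂ] K) := fun n => F n (T n)
  have hTs : ∀ n, (T (n + 1)).1 = (T n).1 - (adjoint (m n)) ∘L (m n) := fun n => rfl
  have hsum : ∀ k, ∑ i ∈ Finset.range k, (adjoint (m i)) ∘L (m i) = 1 - (T k).1 := by
    intro k
    induction k with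
    | zero => simp [T]
    | succ k ih => rw [Finset.sum_range_succ, ih, hTs]; abel
  have hanti : Antitone fun n => (T n).1 := by
    refine antitone_nat_of_succ_le fun n => ?_
    rw [hTs, sub_le_self_iff, nonneg_iff_isPositive]
    exact isPositive_adjoint_comp_self _
  have hT1 : ∀ n, (T n).1 ≤ 1 := fun n => hanti (Nat.zero_le n)
  have hTn : ∀ n, ‖(T n).1‖ ≤ 1 := fun n =>
    (CStarAlgebra.norm_le_one_iff_of_nonneg _ (T n).2.1).2 (hT1 n)
  have hqT : ∀ l, Filter.Tendsto (fun k => ‖q l ∘L (T k).1‖) Filter.atTop (nhds 0) := by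
    intro l
    rw [Metric.tendsto_atTop]
    intro ε hε
    obtain ⟨j, hj⟩ := exists_nat_one_div_lt (show 0 < ε ^ 2 by positivity)
    refine ⟨Nat.pair l j + 1, fun n hn => ?_⟩
    simp only [dist_zero_right, norm_norm]
    have h1 := norm_sq_le (q l) (T n).2.1 (hT1 n)
    have h2 := conj_norm_mono (q l) (T n).2.1 (hanti hn)
    have h3 := hFn (Nat.pair l j) (T (Nat.pair l j))
    rw [Nat.unpair_pair] at h3
    have h4 : (1 : ℝ) / ((Nat.pair l j : ℕ) + 1) ≤ 1 / ((j : ℝ) + 1) := by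
      gcongr
      exact Nat.right_le_pair l j
    have h5 : ‖q l ∘L (T n).1‖ ^ 2 < ε ^ 2 := by
      rw [sq]
      exact lt_of_le_of_lt (h1.trans (h2.trans (h3.trans h4))) hj
    exact lt_of_pow_lt_pow_left₀ 2 hε.le h5
  have heT : ∀ n, Filter.Tendsto (fun k => ‖e n * (T k).1‖) Filter.atTop (nhds 0) := by
    intro n
    refine h₀ n _ hTn fun x hx => ?_
    have : x ∈ Set.range q := hq ▸ Or.inr (Set.mem_iUnion.2 ⟨n, hx⟩)
    obtain ⟨l, rfl⟩ := this
    exact hqT l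
  refine ⟨m, fun i => hFp _ _, fun k => ?_, fun a ha => ?_⟩
  · rw [hsum, CStarAlgebra.norm_le_one_iff_of_nonneg _ (sub_nonneg.2 (hT1 k))]
    exact sub_le_self _ (T k).2.1
  · have h : Filter.Tendsto (fun k => ‖a * (T k).1‖) Filter.atTop (nhds 0) := by
      refine tendsto_closure _ hTn a fun ε hε => ?_
      obtain ⟨n, hn⟩ := ((hai a ha).2.eventually (gt_mem_nhds hε)).exists
      refine ⟨a * e n, by rw [norm_sub_rev]; exact hn.le, ?_⟩
      have := (heT n).const_mul ‖a‖
      rw [mul_zero] at this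
      refine squeeze_zero (fun _ => norm_nonneg _) (fun k => ?_) this
      rw [mul_assoc]; exact norm_mul_le _ _
    refine h.congr fun k => ?_
    rw [hsum, mul_sub, mul_one, sub_sub_cancel_left, norm_neg]
end
end
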